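/- Let p be a Borel probability measure on [0,1]³ with coordinates (X,Y,Z) satisfying W1(p_{X,Y|Z=z}, p_{X,Y|Z=z'}) ≤ L·|z−z'| for all z, z' ∈ [0,1]. Let C ⊆ [0,1] be a measurable set with p_Z(C) > 0. Then for every z' ∈ C: W2(p_{X,Y|Z∈C}, p_{X,Y|Z=z'})² ≤ √2 · L · diam(C). -/

import Mathlib

open MeasureTheory

noncomputable section

/-- A coupling of `μ` and `ν`: a measure on the product whose marginals are `μ` and `ν`. -/
def IsCoupling {α β : Type*} [MeasurableSpace α] [MeasurableSpace β]
    (γ : Measure (α × β)) (μ : Measure α) (ν : Measure β) : Prop :=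
  γ.map Prod.fst = μ ∧ γ.map Prod.snd = ν

/-- The optimal transport cost between `μ` and `ν` for the cost function `cost`. -/
def transportCost {α β : Type*} [MeasurableSpace α] [MeasurableSpace β]
    (cost : α → β → ℝ) (μ : Measure α) (ν : Measure β) : ℝ :=
  sInf {c : ℝ | ∃ γ : Measure (α × β), IsProbabilityMeasure γ ∧ IsCoupling γ μ ν ∧
    c = ∫ z, cost z.1 z.2 ∂γ}

/-- Euclidean distance on `ℝ²` (represented as `ℝ × ℝ`). -/
def eucDist (x y : ℝ × ℝ) : ℝ := Real.sqrt ((x.1 - y.1) ^ 2 + (x.2 - y.2) ^ 2)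

/-- Wasserstein-1 distance on `ℝ²` with Euclidean cost. -/
def W1 (μ ν : Measure (ℝ × ℝ)) : ℝ := transportCost eucDist μ ν

/-- Wasserstein-2 distance on `ℝ²` with Euclidean cost. -/
def W2 (μ ν : Measure (ℝ × ℝ)) : ℝ :=
  Real.sqrt (transportCost (fun x y => (x.1 - y.1) ^ 2 + (x.2 - y.2) ^ 2) μ ν)

/-- Wasserstein-1 distance on `ℝ` with cost `|x - y|`. -/
def W1R (μ ν : Measure ℝ) : ℝ := transportCost (fun x y => |x - y|) μ ν

/-- Wasserstein-2 distance on `ℝ` with cost `|x - y|`. -/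
def W2R (μ ν : Measure ℝ) : ℝ :=
  Real.sqrt (transportCost (fun x y => (x - y) ^ 2) μ ν)

/-- The unit square `[0,1]² ⊆ ℝ²`. -/
def unitSq : Set (ℝ × ℝ) := Set.Icc 0 1 ×ˢ Set.Icc 0 1

/-- The unit interval `[0,1] ⊆ ℝ`. -/
def unitI : Set ℝ := Set.Icc 0 1

/-- `κ` is a regular conditional distribution (a Markov kernel, supported on `[0,1]²`) of
`(X,Y)` given `Z = z`, for a probability measure `p` on `[0,1]³ ⊆ (ℝ × ℝ) × ℝ` whose first
coordinate is `(X,Y)` and second coordinate is `Z`. -/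
def IsCondKernel (p : Measure ((ℝ × ℝ) × ℝ)) (κ : ℝ → Measure (ℝ × ℝ)) : Prop :=
  (∀ z, IsProbabilityMeasure (κ z)) ∧
  (∀ z ∈ unitI, κ z unitSq = 1) ∧
  (∀ A : Set (ℝ × ℝ), MeasurableSet A → Measurable fun z => κ z A) ∧
  (∀ A : Set (ℝ × ℝ), MeasurableSet A → ∀ B : Set ℝ, MeasurableSet B →
    p (A ×ˢ B) = ∫⁻ z in B, κ z A ∂(p.map Prod.snd))

/-- The product of the two marginals of a measure on `ℝ²`. -/
def prodMargins (μ : Measure (ℝ × ℝ)) : Measure (ℝ × ℝ) :=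
  (μ.map Prod.fst).prod (μ.map Prod.snd)

/-- The conditional distribution of `(X,Y)` given `Z ∈ C`, i.e. the normalized mixture
`A ↦ (1 / p_Z(C)) ∫_C κ_z(A) dp_Z(z)`. -/
def condBin (p : Measure ((ℝ × ℝ) × ℝ)) (κ : ℝ → Measure (ℝ × ℝ)) (C : Set ℝ) :
    Measure (ℝ × ℝ) :=
  (p.map Prod.snd C)⁻¹ • ((p.map Prod.snd).restrict C).bind κ

/-- Wasserstein-1 Lipschitz smoothness of the conditional distributions:
`W1(p_{X,Y|Z=z}, p_{X,Y|Z=z'}) ≤ L·|z - z'|` for all `z, z' ∈ [0,1]`. -/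
def WSmooth (L : ℝ) (κ : ℝ → Measure (ℝ × ℝ)) : Prop :=
  ∀ z ∈ unitI, ∀ z' ∈ unitI, W1 (κ z) (κ z') ≤ L * |z - z'|

open ProbabilityTheory in
lemma glue_aux {α G : Type*} [MeasurableSpace α] [Fintype G] [MeasurableSpace G]
    [MeasurableSingletonClass G] (T : α → G) (hT : Measurable T)
    (μ ν : Measure α) [IsProbabilityMeasure μ] [IsProbabilityMeasure ν]
    (q : G → G → ENNReal) (hrow : ∀ g, ∑ h, q g h = μ (T ⁻¹' {g}))
    (hcol : ∀ h, ∑ g, q g h = ν (T ⁻¹' {h})) :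
    ∃ γ : Measure (α × α), IsProbabilityMeasure γ ∧ IsCoupling γ μ ν ∧
      ∀ g h, γ ((T ⁻¹' {g}) ×ˢ (T ⁻¹' {h})) = q g h := by
  classical
  have hm : ∀ g, MeasurableSet (T ⁻¹' {g}) := fun g => hT (measurableSet_singleton g)
  have hq1 : ∀ g h, μ (T ⁻¹' {g}) = 0 → q g h = 0 := by
    intro g h h0
    rw [← hrow g] at h0
    exact (Finset.sum_eq_zero_iff.1 h0) h (Finset.mem_univ _)
  have hq2 : ∀ g h, ν (T ⁻¹' {h}) = 0 → q g h = 0 := by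
    intro g h h0
    rw [← hcol h] at h0
    exact (Finset.sum_eq_zero_iff.1 h0) g (Finset.mem_univ _)
  have hsum : ∀ (ρ : Measure α) (A : Set α), MeasurableSet A →
      ∑ g, ρ ((T ⁻¹' {g}) ∩ A) = ρ A := by
    intro ρ A hA
    have h1 : A = ⋃ g ∈ (Finset.univ : Finset G), (T ⁻¹' {g}) ∩ A := by
      ext x; simp
    conv_rhs => rw [h1]
    rw [measure_biUnion_finset]
    · intro a _ b _ hab
      refine Set.disjoint_left.2 ?_
      rintro x ⟨hx, _⟩ ⟨hx', _⟩
      simp only [Set.mem_preimage, Set.mem_singleton_iff] at hx hx'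
      exact hab (hx.symm.trans hx')
    · intro g _
      exact (hm g).inter hA
  let γ : Measure (α × α) := ∑ g, ∑ h, q g h • (μ[|T ⁻¹' {g}]).prod (ν[|T ⁻¹' {h}])
  have hγ : ∀ A B : Set α, γ (A ×ˢ B) =
      ∑ g, ∑ h, q g h * (μ[A | T ⁻¹' {g}] * ν[B | T ⁻¹' {h}]) := by
    intro A B
    simp only [γ, Measure.finsetSum_apply, Measure.smul_apply, smul_eq_mul, Measure.prod_prod]
  have c1 : ∀ g, μ (T ⁻¹' {g}) ≠ 0 → μ[Set.univ | T ⁻¹' {g}] = 1 := by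
    intro g hg
    have := cond_isProbabilityMeasure hg
    exact measure_univ
  have c2 : ∀ g, ν (T ⁻¹' {g}) ≠ 0 → ν[Set.univ | T ⁻¹' {g}] = 1 := by
    intro g hg
    have := cond_isProbabilityMeasure hg
    exact measure_univ
  have m1 : γ.map Prod.fst = μ := by
    ext A hA
    rw [Measure.map_apply measurable_fst hA, ← Set.prod_univ, hγ, ← hsum μ A hA]
    refine Finset.sum_congr rfl fun g _ => ?_
    rw [← cond_mul_eq_inter (hm g), ← hrow g, Finset.mul_sum]
    refine Finset.sum_congr rfl fun h _ => ?_
    by_cases h0 : ν (T ⁻¹' {h}) = 0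
    · simp [hq2 g h h0]
    · rw [c2 h h0, mul_one, mul_comm]
  have m2 : γ.map Prod.snd = ν := by
    ext A hA
    rw [Measure.map_apply measurable_snd hA, ← Set.univ_prod, hγ, ← hsum ν A hA,
      Finset.sum_comm]
    refine Finset.sum_congr rfl fun g _ => ?_
    rw [← cond_mul_eq_inter (hm g), ← hcol g, Finset.mul_sum]
    refine Finset.sum_congr rfl fun h _ => ?_
    by_cases h0 : μ (T ⁻¹' {h}) = 0
    · simp [hq1 h g h0]
    · rw [c1 h h0, one_mul, mul_comm]
  refine ⟨γ, ⟨?_⟩, ⟨m1, m2⟩, ?_⟩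
  · have : γ Set.univ = γ.map Prod.fst Set.univ := by
      rw [Measure.map_apply measurable_fst MeasurableSet.univ, Set.preimage_univ]
    rw [this, m1, measure_univ]
  · intro g h
    rw [hγ, Finset.sum_eq_single g, Finset.sum_eq_single h]
    · by_cases h0 : μ (T ⁻¹' {g}) = 0
      · simp [hq1 g h h0]
      by_cases h1 : ν (T ⁻¹' {h}) = 0
      · simp [hq2 g h h1]
      rw [cond_apply_self h0 (measure_ne_top _ _), cond_apply_self h1 (measure_ne_top _ _)]
      simp
    · intro b _ hb
      have : (T ⁻¹' {b}) ∩ (T ⁻¹' {h}) = ∅ := by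
        ext x
        simp only [Set.mem_inter_iff, Set.mem_preimage, Set.mem_singleton_iff,
          Set.mem_empty_iff_false, iff_false]
        rintro ⟨h1, h2⟩
        exact hb (h1.symm.trans h2)
      rw [cond_apply (hm b) ν, this]
      simp
    · simp
    · intro b _ hb
      have : (T ⁻¹' {b}) ∩ (T ⁻¹' {g}) = ∅ := by
        ext x
        simp only [Set.mem_inter_iff, Set.mem_preimage, Set.mem_singleton_iff,
          Set.mem_empty_iff_false, iff_false]
        rintro ⟨h1, h2⟩
        exact hb (h1.symm.trans h2)
      refine Finset.sum_eq_zero fun h' _ => ?_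
      rw [cond_apply (hm b) μ, this]
      simp
    · simp

/-- The set of finite marginals coupled to `b` with cost at most `c`. -/
def finSet {G : Type*} [Fintype G] (d : G → G → ℝ) (b : G → ℝ) (c : ℝ) : Set (G → ℝ) :=
  {a | ∃ q : G → G → ℝ, (∀ g h, 0 ≤ q g h) ∧ (∀ g, ∑ h, q g h = a g) ∧
    (∀ h, ∑ g, q g h = b h) ∧ ∑ g, ∑ h, q g h * d g h ≤ c}

lemma finSet_convex {G : Type*} [Fintype G] (d : G → G → ℝ) (b : G → ℝ) (c : ℝ) :
    Convex ℝ (finSet d b c) := by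
  rintro a ⟨q, q0, qr, qc, qd⟩ a' ⟨q', q0', qr', qc', qd'⟩ s t hs ht hst
  refine ⟨fun g h => s * q g h + t * q' g h, ?_, ?_, ?_, ?_⟩
  · intro g h
    have := q0 g h
    have := q0' g h
    positivity
  · intro g
    simp [Finset.sum_add_distrib, ← Finset.mul_sum, qr, qr']
  · intro g
    simp only [Finset.sum_add_distrib, ← Finset.mul_sum, qc, qc']
    rw [← add_mul, hst, one_mul]
  · have : ∑ g, ∑ h, (s * q g h + t * q' g h) * d g h =
        s * ∑ g, ∑ h, q g h * d g h + t * ∑ g, ∑ h, q' g h * d g h := by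
      simp only [Finset.mul_sum, ← Finset.sum_add_distrib]
      refine Finset.sum_congr rfl fun g _ => Finset.sum_congr rfl fun h _ => ?_
      ring
    rw [this]
    have h1 := mul_le_mul_of_nonneg_left qd hs
    have h2 := mul_le_mul_of_nonneg_left qd' ht
    have h3 : s * c + t * c = c := by rw [← add_mul, hst, one_mul]
    linarith

lemma finSet_closed {G : Type*} [Fintype G] (d : G → G → ℝ) (b : G → ℝ) (c : ℝ) :
    IsClosed (finSet d b c) := by
  let K : Set (G → G → ℝ) := {q | (∀ g h, 0 ≤ q g h) ∧
    (∀ h, ∑ g, q g h = b h) ∧ ∑ g, ∑ h, q g h * d g h ≤ c}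
  have hKc : IsClosed K := by
    have e : K = (⋂ g, ⋂ h, {q : G → G → ℝ | 0 ≤ q g h}) ∩
      ((⋂ h, {q : G → G → ℝ | ∑ g, q g h = b h}) ∩
        {q : G → G → ℝ | ∑ g, ∑ h, q g h * d g h ≤ c}) := by
      ext q; simp [K]
    rw [e]
    refine IsClosed.inter ?_ (IsClosed.inter ?_ ?_)
    · exact isClosed_iInter fun g => isClosed_iInter fun h =>
        isClosed_le (by fun_prop) (by fun_prop)
    · exact isClosed_iInter fun h => isClosed_eq (by fun_prop) (by fun_prop)
    · exact isClosed_le (by fun_prop) (by fun_prop)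
  have hK : IsCompact K := by
    refine IsCompact.of_isClosed_subset
      (isCompact_univ_pi (s := fun _ : G => Set.pi Set.univ fun h : G => Set.Icc 0 (b h))
        fun g => isCompact_univ_pi fun h => isCompact_Icc) hKc ?_
    rintro q ⟨q0, qc, _⟩ g _ h _
    refine ⟨q0 g h, ?_⟩
    rw [← qc h]
    exact Finset.single_le_sum (f := fun g => q g h) (fun i _ => q0 i h) (Finset.mem_univ g)
  have himg : finSet d b c = (fun (q : G → G → ℝ) g => ∑ h, q g h) '' K := by
    ext a
    constructor
    · rintro ⟨q, q0, qr, qc, qd⟩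
      exact ⟨q, ⟨q0, qc, qd⟩, funext qr⟩
    · rintro ⟨q, ⟨q0, qc, qd⟩, rfl⟩
      exact ⟨q, q0, fun g => rfl, qc, qd⟩
  rw [himg]
  exact (hK.image (by fun_prop)).isClosed

lemma integral_fin_aux {α G : Type*} [MeasurableSpace α] [Fintype G] [MeasurableSpace G]
    [MeasurableSingletonClass G] (T : α → G) (hT : Measurable T)
    (γ : Measure (α × α)) [IsProbabilityMeasure γ] (d : G → G → ℝ) :
    Integrable (fun z : α × α => d (T z.1) (T z.2)) γ ∧
    ∫ z, d (T z.1) (T z.2) ∂γ =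
      ∑ g, ∑ h, γ.real ((T ⁻¹' {g}) ×ˢ (T ⁻¹' {h})) * d g h := by
  have hTT : Measurable (fun z : α × α => (T z.1, T z.2)) := by fun_prop
  have : IsProbabilityMeasure (γ.map (fun z : α × α => (T z.1, T z.2))) :=
    Measure.isProbabilityMeasure_map hTT.aemeasurable
  have hi : Integrable (fun w : G × G => d w.1 w.2)
      (γ.map (fun z : α × α => (T z.1, T z.2))) := Integrable.of_finite
  constructor
  · exact hi.comp_measurable hTT
  · have h1 := integral_map (μ := γ) hTT.aemeasurable hi.aestronglyMeasurable
    simp only at h1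
    rw [← h1, integral_fintype hi, Fintype.sum_prod_type]
    refine Finset.sum_congr rfl fun g _ => Finset.sum_congr rfl fun h _ => ?_
    rw [map_measureReal_apply hTT (measurableSet_singleton _), smul_eq_mul]
    congr 2
    ext z
    simp [Prod.ext_iff]

/-- Squared Euclidean cost. -/
def sqCost (x y : ℝ × ℝ) : ℝ := (x.1 - y.1) ^ 2 + (x.2 - y.2) ^ 2

/-- Grid index map. -/
def gridT (n : ℕ) (x : ℝ × ℝ) : Fin (n + 1) × Fin (n + 1) :=
  (Fin.ofNat (n + 1) ⌊n * x.1⌋₊, Fin.ofNat (n + 1) ⌊n * x.2⌋₊)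

/-- Grid point. -/
def gridE (n : ℕ) (i : Fin (n + 1) × Fin (n + 1)) : ℝ × ℝ :=
  ((i.1 : ℕ) / (n : ℝ), (i.2 : ℕ) / (n : ℝ))

lemma gridT_meas (n : ℕ) : Measurable (gridT n) := by
  unfold gridT
  refine Measurable.prodMk ?_ ?_
  · exact (measurable_from_top (f := fun k : ℕ => Fin.ofNat (n + 1) k)).comp
      (Nat.measurable_floor.comp (by fun_prop))
  · exact (measurable_from_top (f := fun k : ℕ => Fin.ofNat (n + 1) k)).comp
      (Nat.measurable_floor.comp (by fun_prop))

lemma grid1 (n : ℕ) (hn : 0 < n) (t : ℝ) (h0 : 0 ≤ t) (h1 : t ≤ 1) :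
    |t - ((Fin.ofNat (n + 1) ⌊n * t⌋₊ : Fin (n + 1)) : ℕ) / (n : ℝ)| ≤ 1 / n ∧
    0 ≤ (((Fin.ofNat (n + 1) ⌊n * t⌋₊ : Fin (n + 1)) : ℕ) / (n : ℝ)) ∧
    (((Fin.ofNat (n + 1) ⌊n * t⌋₊ : Fin (n + 1)) : ℕ) / (n : ℝ)) ≤ 1 := by
  have hn' : (0 : ℝ) < n := by exact_mod_cast hn
  have hnt : (0 : ℝ) ≤ n * t := by positivity
  have a := Nat.floor_le hnt
  have b := Nat.lt_floor_add_one (n * t)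
  have hle : ⌊n * t⌋₊ ≤ n := by
    apply Nat.floor_le_of_le
    nlinarith
  have e : ((Fin.ofNat (n + 1) ⌊n * t⌋₊ : Fin (n + 1)) : ℕ) = ⌊n * t⌋₊ := by
    simp [Fin.ofNat, Nat.mod_eq_of_lt (Nat.lt_succ_of_le hle)]
  rw [e]
  refine ⟨?_, by positivity, ?_⟩
  · have : t - (⌊n * t⌋₊ : ℝ) / n = (n * t - ⌊n * t⌋₊) / n := by field_simp
    rw [this, abs_of_nonneg (div_nonneg (by linarith) hn'.le)]
    gcongr
    linarith
  · rw [div_le_one hn']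
    exact_mod_cast hle

lemma sq_close (a b a' b' e : ℝ) (ha : 0 ≤ a) (ha1 : a ≤ 1) (hb : 0 ≤ b) (hb1 : b ≤ 1)
    (ha' : 0 ≤ a') (ha1' : a' ≤ 1) (hb' : 0 ≤ b') (hb1' : b' ≤ 1)
    (h1 : |a - a'| ≤ e) (h2 : |b - b'| ≤ e) : |(a - b) ^ 2 - (a' - b') ^ 2| ≤ 4 * e := by
  have : (a - b) ^ 2 - (a' - b') ^ 2 = ((a - b) + (a' - b')) * ((a - a') - (b - b')) := by ring
  rw [this, abs_mul]
  have h3 : |(a - b) + (a' - b')| ≤ 2 := by rw [abs_le]; constructor <;> linarith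
  have h4 : |(a - a') - (b - b')| ≤ 2 * e := by
    rw [abs_le] at *; constructor <;> linarith
  calc _ ≤ 2 * (2 * e) := by gcongr
    _ = 4 * e := by ring

lemma grid_close (n : ℕ) (hn : 0 < n) (x y : ℝ × ℝ) (hx : x ∈ unitSq) (hy : y ∈ unitSq) :
    |sqCost x y - sqCost (gridE n (gridT n x)) (gridE n (gridT n y))| ≤ 8 / n := by
  obtain ⟨⟨hx1, hx2⟩, ⟨hx3, hx4⟩⟩ := hx
  obtain ⟨⟨hy1, hy2⟩, ⟨hy3, hy4⟩⟩ := hy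
  obtain ⟨a1, a2, a3⟩ := grid1 n hn x.1 hx1 hx2
  obtain ⟨b1, b2, b3⟩ := grid1 n hn x.2 hx3 hx4
  obtain ⟨c1, c2, c3⟩ := grid1 n hn y.1 hy1 hy2
  obtain ⟨d1, d2, d3⟩ := grid1 n hn y.2 hy3 hy4
  have k1 := sq_close _ _ _ _ _ hx1 hx2 hy1 hy2 a2 a3 c2 c3 a1 c1
  have k2 := sq_close _ _ _ _ _ hx3 hx4 hy3 hy4 b2 b3 d2 d3 b1 d1
  have e : (8 : ℝ) / n = 4 * (1 / n) + 4 * (1 / n) := by ring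
  rw [e]
  unfold sqCost gridE gridT
  simp only
  rw [abs_le] at *
  constructor <;> linarith

lemma sqCost_le (x y : ℝ × ℝ) (hx : x ∈ unitSq) (hy : y ∈ unitSq) :
    sqCost x y ≤ Real.sqrt 2 * eucDist x y ∧ sqCost x y ≤ 2 := by
  obtain ⟨⟨hx1, hx2⟩, ⟨hx3, hx4⟩⟩ := hx
  obtain ⟨⟨hy1, hy2⟩, ⟨hy3, hy4⟩⟩ := hy
  have h2 : sqCost x y ≤ 2 := by
    unfold sqCost
    have : (x.1 - y.1) ^ 2 ≤ 1 := by
      rw [sq_le_one_iff_abs_le_one, abs_le]; constructor <;> linarith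
    have : (x.2 - y.2) ^ 2 ≤ 1 := by
      rw [sq_le_one_iff_abs_le_one, abs_le]; constructor <;> linarith
    linarith
  refine ⟨?_, h2⟩
  have h0 : 0 ≤ sqCost x y := by unfold sqCost; positivity
  have he : eucDist x y = Real.sqrt (sqCost x y) := rfl
  rw [he]
  calc sqCost x y = Real.sqrt (sqCost x y) * Real.sqrt (sqCost x y) :=
        (Real.mul_self_sqrt h0).symm
    _ ≤ _ := by gcongr

lemma coupling_ae {γ : Measure ((ℝ × ℝ) × (ℝ × ℝ))} {μ ν : Measure (ℝ × ℝ)}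
    [IsProbabilityMeasure μ] [IsProbabilityMeasure ν]
    (h : IsCoupling γ μ ν) (hμ : μ unitSq = 1) (hν : ν unitSq = 1) :
    ∀ᵐ z ∂γ, z.1 ∈ unitSq ∧ z.2 ∈ unitSq := by
  have hm : MeasurableSet unitSq := measurableSet_Icc.prod measurableSet_Icc
  obtain ⟨h1, h2⟩ := h
  have a1 : ∀ᵐ x ∂(γ.map Prod.fst), x ∈ unitSq := by
    rw [h1]; exact (prob_compl_eq_zero_iff hm).2 hμ
  have a2 : ∀ᵐ x ∂(γ.map Prod.snd), x ∈ unitSq := by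
    rw [h2]; exact (prob_compl_eq_zero_iff hm).2 hν
  filter_upwards [ae_of_ae_map measurable_fst.aemeasurable a1,
    ae_of_ae_map measurable_snd.aemeasurable a2] with z hz1 hz2
  exact ⟨hz1, hz2⟩

lemma sqCost_int {γ : Measure ((ℝ × ℝ) × (ℝ × ℝ))} [IsProbabilityMeasure γ]
    (h : ∀ᵐ z ∂γ, z.1 ∈ unitSq ∧ z.2 ∈ unitSq) :
    Integrable (fun z => sqCost z.1 z.2) γ ∧ Integrable (fun z => eucDist z.1 z.2) γ := by
  constructor
  · refine Integrable.of_bound (C := 2) ?_ ?_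
    · unfold sqCost
      exact Measurable.aestronglyMeasurable (by fun_prop)
    · filter_upwards [h] with z hz
      have h0 : 0 ≤ sqCost z.1 z.2 := by unfold sqCost; positivity
      rw [Real.norm_of_nonneg h0]
      exact (sqCost_le _ _ hz.1 hz.2).2
  · refine Integrable.of_bound (C := Real.sqrt 2) ?_ ?_
    · unfold eucDist
      exact Measurable.aestronglyMeasurable (by fun_prop)
    · filter_upwards [h] with z hz
      have h0 : 0 ≤ eucDist z.1 z.2 := Real.sqrt_nonneg _
      rw [Real.norm_of_nonneg h0]
      exact Real.sqrt_le_sqrt (sqCost_le _ _ hz.1 hz.2).2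

lemma fin_of_W1 (n : ℕ) (hn : 0 < n) (μ ν : Measure (ℝ × ℝ)) [IsProbabilityMeasure μ]
    [IsProbabilityMeasure ν] (hμ : μ unitSq = 1) (hν : ν unitSq = 1) (D : ℝ)
    (hD : W1 μ ν < D) :
    (fun g => μ.real (gridT n ⁻¹' {g})) ∈
      finSet (fun g h => sqCost (gridE n g) (gridE n h)) (fun g => ν.real (gridT n ⁻¹' {g}))
        (Real.sqrt 2 * D + 8 / n) := by
  have hT := gridT_meas n
  have hm : ∀ g, MeasurableSet (gridT n ⁻¹' {g}) := fun g => hT (measurableSet_singleton g)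
  unfold W1 transportCost at hD
  obtain ⟨c, ⟨γ, hγ, hc, rfl⟩, hlt⟩ := exists_lt_of_csInf_lt (by
    exact ⟨_, ⟨μ.prod ν, inferInstance, ⟨by simp, by simp⟩, rfl⟩⟩) hD
  have hae := coupling_ae hc hμ hν
  obtain ⟨i1, i2⟩ := sqCost_int hae
  obtain ⟨j1, j2⟩ := integral_fin_aux (gridT n) hT γ
    (fun g h => sqCost (gridE n g) (gridE n h))
  have hdis : Pairwise (Function.onFun Disjoint fun g => gridT n ⁻¹' {g}) := by
    intro a b hab
    exact Disjoint.preimage _ (by simpa using hab)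
  refine ⟨fun g h => γ.real ((gridT n ⁻¹' {g}) ×ˢ (gridT n ⁻¹' {h})), ?_, ?_, ?_, ?_⟩
  · intro g h; exact measureReal_nonneg
  · intro g
    simp only
    rw [← hc.1, map_measureReal_apply measurable_fst (hm g),
      ← measureReal_biUnion_finset]
    · congr 1
      ext z
      simp
    · intro a _ b _ hab
      exact Set.disjoint_prod.2 (Or.inr (hdis hab))
    · intro h _
      exact (hm g).prod (hm h)
  · intro g
    simp only
    rw [← hc.2, map_measureReal_apply measurable_snd (hm g),
      ← measureReal_biUnion_finset]
    · congr 1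
      ext z
      simp
    · intro a _ b _ hab
      exact Set.disjoint_prod.2 (Or.inl (hdis hab))
    · intro h _
      exact (hm h).prod (hm g)
  · rw [← j2]
    calc _ ≤ ∫ z, (Real.sqrt 2 * eucDist z.1 z.2 + 8 / n) ∂γ := by
          refine integral_mono_ae j1 ((i2.const_mul _).add (integrable_const _)) ?_
          filter_upwards [hae] with z hz
          have h1 := abs_le.1 (grid_close n hn _ _ hz.1 hz.2)
          have h2 := (sqCost_le _ _ hz.1 hz.2).1
          linarith
      _ = Real.sqrt 2 * ∫ z, eucDist z.1 z.2 ∂γ + 8 / n := by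
          rw [integral_add (i2.const_mul _) (integrable_const _), integral_const_mul]
          simp
      _ ≤ _ := by gcongr

lemma cost_of_fin (n : ℕ) (hn : 0 < n) (μ ν : Measure (ℝ × ℝ)) [IsProbabilityMeasure μ]
    [IsProbabilityMeasure ν] (hμ : μ unitSq = 1) (hν : ν unitSq = 1) (c : ℝ)
    (h : (fun g => μ.real (gridT n ⁻¹' {g})) ∈
      finSet (fun g h => sqCost (gridE n g) (gridE n h)) (fun g => ν.real (gridT n ⁻¹' {g})) c) :
    transportCost sqCost μ ν ≤ c + 8 / n := by
  have hT := gridT_meas n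
  obtain ⟨q, q0, qr, qc, qd⟩ := h
  obtain ⟨γ, hγ, hc, hq⟩ := glue_aux (gridT n) hT μ ν (fun g h => ENNReal.ofReal (q g h))
    (by
      intro g
      rw [← ENNReal.ofReal_sum_of_nonneg (fun i _ => q0 g i), qr g]
      exact ofReal_measureReal)
    (by
      intro g
      rw [← ENNReal.ofReal_sum_of_nonneg (fun i _ => q0 i g), qc g]
      exact ofReal_measureReal)
  have hae := coupling_ae hc hμ hν
  obtain ⟨i1, i2⟩ := sqCost_int hae
  obtain ⟨j1, j2⟩ := integral_fin_aux (gridT n) hT γ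
    (fun g h => sqCost (gridE n g) (gridE n h))
  have hle : transportCost sqCost μ ν ≤ ∫ z, sqCost z.1 z.2 ∂γ := by
    refine csInf_le ⟨0, ?_⟩ ⟨γ, hγ, hc, rfl⟩
    rintro _ ⟨γ', _, _, rfl⟩
    exact integral_nonneg fun z => by
      show 0 ≤ sqCost z.1 z.2
      unfold sqCost; positivity
  refine hle.trans ?_
  calc _ ≤ ∫ z, (sqCost (gridE n (gridT n z.1)) (gridE n (gridT n z.2)) + 8 / n) ∂γ := by
        refine integral_mono_ae i1 (j1.add (integrable_const _)) ?_
        filter_upwards [hae] with z hz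
        have h1 := abs_le.1 (grid_close n hn _ _ hz.1 hz.2)
        linarith
    _ = (∑ g, ∑ h, q g h * sqCost (gridE n g) (gridE n h)) + 8 / n := by
        rw [integral_add j1 (integrable_const _), j2]
        simp [Measure.real, hq, q0]
    _ ≤ _ := by gcongr

/-- If the conditional distributions are `W1`-Lipschitz in `z` with
constant `L`, then for any measurable `C ⊆ [0,1]` of positive `p_Z`-measure and any
`z' ∈ C`: `W2(p_{X,Y|Z∈C}, p_{X,Y|Z=z'})² ≤ √2·L·diam(C)`. -/
theorem w2_sq_condBin_le (L : ℝ) (p : Measure ((ℝ × ℝ) × ℝ)) [IsProbabilityMeasure p]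
    (hsupp : p (unitSq ×ˢ unitI) = 1)
    (κ : ℝ → Measure (ℝ × ℝ)) (hκ : IsCondKernel p κ) (hsmooth : WSmooth L κ)
    (C : Set ℝ) (hC : MeasurableSet C) (hC01 : C ⊆ unitI)
    (hCpos : 0 < p.map Prod.snd C) :
    ∀ z' ∈ C, W2 (condBin p κ C) (κ z') ^ 2 ≤ Real.sqrt 2 * L * Metric.diam C := by
  intro z' hz'
  obtain ⟨hprob, hsq, hmeas, -⟩ := hκ
  have hκm : Measurable κ := Measure.measurable_of_measurable_coe _ hmeas
  have hpZ : IsProbabilityMeasure (p.map Prod.snd) :=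
    Measure.isProbabilityMeasure_map measurable_snd.aemeasurable
  let Q : Measure ℝ := ProbabilityTheory.cond (p.map Prod.snd) C
  have hQ : IsProbabilityMeasure Q := ProbabilityTheory.cond_isProbabilityMeasure hCpos.ne'
  have hQC : ∀ᵐ z ∂Q, z ∈ C := ProbabilityTheory.ae_cond_mem hC
  have happ : ∀ A, MeasurableSet A → condBin p κ C A = ∫⁻ z, κ z A ∂Q := by
    intro A hA
    simp only [condBin, Q, ProbabilityTheory.cond, Measure.smul_apply, lintegral_smul_measure]
    rw [Measure.bind_apply hA hκm.aemeasurable]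
  have hsqm : MeasurableSet unitSq := measurableSet_Icc.prod measurableSet_Icc
  have hB : IsProbabilityMeasure (condBin p κ C) := by
    constructor
    rw [happ _ MeasurableSet.univ]
    simp
  have hBsq : condBin p κ C unitSq = 1 := by
    rw [happ _ hsqm]
    have : ∫⁻ z, κ z unitSq ∂Q = ∫⁻ z, 1 ∂Q := by
      refine lintegral_congr_ae ?_
      filter_upwards [hQC] with z hz
      exact hsq z (hC01 hz)
    rw [this]; simp
  have hL : 0 ≤ L := by
    have h := hsmooth 0 (by simp [unitI]) 1 (by simp [unitI])
    have h0 : 0 ≤ W1 (κ 0) (κ 1) := by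
      refine Real.sInf_nonneg ?_
      rintro _ ⟨γ', _, _, rfl⟩
      exact integral_nonneg fun z => Real.sqrt_nonneg _
    simp at h
    linarith
  have hbd : Bornology.IsBounded C := (Metric.isBounded_Icc 0 1).subset hC01
  have key : ∀ n : ℕ, 0 < n → transportCost sqCost (condBin p κ C) (κ z') ≤
      Real.sqrt 2 * (L * Metric.diam C + 1 / n) + 8 / n + 8 / n := by
    intro n hn
    have hn' : (0 : ℝ) < n := by exact_mod_cast hn
    refine cost_of_fin n hn _ _ hBsq (hsq _ (hC01 hz')) _ ?_
    have hm : ∀ g, MeasurableSet (gridT n ⁻¹' {g}) :=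
      fun g => gridT_meas n (measurableSet_singleton g)
    have hint : ∀ g, Integrable (fun z => (κ z).real (gridT n ⁻¹' {g})) Q := by
      intro g
      refine Integrable.of_bound (C := 1) ?_ ?_
      · exact (hmeas _ (hm g)).ennreal_toReal.aestronglyMeasurable
      · refine Filter.Eventually.of_forall fun z => ?_
        rw [Real.norm_of_nonneg measureReal_nonneg]
        exact measureReal_le_one
    have hmem := (finSet_convex (fun g h => sqCost (gridE n g) (gridE n h))
      (fun g => (κ z').real (gridT n ⁻¹' {g}))
      (Real.sqrt 2 * (L * Metric.diam C + 1 / n) + 8 / n)).integral_mem (μ := Q)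
      (f := fun z g => (κ z).real (gridT n ⁻¹' {g})) (finSet_closed _ _ _)
      (by
        filter_upwards [hQC] with z hz
        refine fin_of_W1 n hn _ _ (hsq _ (hC01 hz)) (hsq _ (hC01 hz')) _ ?_
        have h1 := hsmooth z (hC01 hz) z' (hC01 hz')
        have h2 : |z - z'| ≤ Metric.diam C := Metric.dist_le_diam_of_mem hbd hz hz'
        have h3 := mul_le_mul_of_nonneg_left h2 hL
        have h4 : (0 : ℝ) < 1 / n := by positivity
        linarith)
      (Integrable.of_eval hint)
    convert hmem using 1
    funext g
    rw [eval_integral hint]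
    rw [measureReal_def, happ _ (hm g)]
    rw [← integral_toReal (hmeas _ (hm g)).aemeasurable
      (Filter.Eventually.of_forall fun z => measure_lt_top _ _)]
    rfl
  have hlim : Filter.Tendsto (fun n : ℕ => Real.sqrt 2 * (L * Metric.diam C + 1 / (n : ℝ))
      + 8 / (n : ℝ) + 8 / (n : ℝ)) Filter.atTop
      (nhds (Real.sqrt 2 * (L * Metric.diam C + 0) + 0 + 0)) := by
    have h1 := tendsto_const_div_atTop_nhds_zero_nat (1 : ℝ)
    have h8 := tendsto_const_div_atTop_nhds_zero_nat (8 : ℝ)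
    exact (((h1.const_add _).const_mul _).add h8).add h8
  have hfin : transportCost sqCost (condBin p κ C) (κ z') ≤
      Real.sqrt 2 * (L * Metric.diam C + 0) + 0 + 0 := by
    refine ge_of_tendsto hlim ?_
    filter_upwards [Filter.eventually_gt_atTop 0] with n hn
    exact key n hn
  have h0 : 0 ≤ transportCost sqCost (condBin p κ C) (κ z') := by
    refine Real.sInf_nonneg ?_
    rintro _ ⟨γ', _, _, rfl⟩
    exact integral_nonneg fun z => by
      show 0 ≤ sqCost z.1 z.2
      unfold sqCost; positivity
  have hW : W2 (condBin p κ C) (κ z') ^ 2 = transportCost sqCost (condBin p κ C) (κ z') :=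
    Real.sq_sqrt h0
  rw [hW]
  linarith

end
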